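/- arXiv:1103.1235 — 4 statements merged into one kernel-verified Lean document; each statement's English description precedes it below -/
import Mathlib

section
/- Assume the set of primes of M is S = {P_n : n ∈ ℕ, n ≥ 1} ∪ {P_∞}, where P₁ ⊋ P₂ ⊋ P₃ ⊋ ⋯ is a strictly decreasing chain of primes and P_∞ ⊊ P_n for every n ≥ 1. Then the closed subsets of the topology on S whose closed sets are the sets Z(F) are precisely: the empty set, the whole space S, the singleton {P_∞}, and the tails {P_k : k ≥ m} ∪ {P_∞} for integers m ≥ 2. -/
/-- A subset `P ⊆ M` is a *prime* (abstracting Balmer's prime thick ⊗-ideals). -/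
def IsPrimeSubset {M : Type*} (mul add : M → M → M) (z : M) (P : Set M) : Prop :=
  z ∈ P ∧ (∀ a b : M, add a b ∈ P ↔ a ∈ P ∧ b ∈ P) ∧
    (∀ a b : M, mul a b ∈ P ↔ a ∈ P ∨ b ∈ P)

/-- The set `S` of all primes of `M`. -/
abbrev PrimeSpace {M : Type*} (mul add : M → M → M) (z : M) : Type _ :=
  {P : Set M // IsPrimeSubset mul add z P}

/-- `Z F := {P ∈ S : F ∩ P = ∅}`. -/
def ZSet {M : Type*} (mul add : M → M → M) (z : M) (F : Set M) :
    Set (PrimeSpace mul add z) :=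
  {P : PrimeSpace mul add z | F ∩ P.1 = ∅}

/-- `Z Qᶜ` is the set of primes contained in `Q`. -/
theorem ZSet_compl {M : Type*} (mul add : M → M → M) (z : M) (Q : Set M) :
    ZSet mul add z Qᶜ = {x : PrimeSpace mul add z | x.1 ⊆ Q} := by
  ext x
  simp only [ZSet, Set.mem_ofPred_eq, ← Set.disjoint_iff_inter_eq_empty,
    Set.disjoint_compl_left_iff_subset]

/-- `Z F` is stable under passing to smaller primes. -/
theorem mem_ZSet_of_subset {M : Type*} {mul add : M → M → M} {z : M} {F : Set M}
    {x y : PrimeSpace mul add z} (hyx : y.1 ⊆ x.1) (hx : x ∈ ZSet mul add z F) :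
    y ∈ ZSet mul add z F :=
  Set.subset_eq_empty (Set.inter_subset_inter_right F hyx) hx

/-- A chain that strictly decreases from index `1` on reverses the order of indices. -/
theorem subset_iff_le_of_chain {M : Type*} {Pn : ℕ → Set M}
    (hchain : ∀ n : ℕ, 1 ≤ n → Pn (n + 1) ⊂ Pn n) {m k : ℕ} (hm : 1 ≤ m) (hk : 1 ≤ k) :
    Pn k ⊆ Pn m ↔ m ≤ k := by
  have anti : ∀ {a b : ℕ}, 1 ≤ a → a ≤ b → Pn b ⊆ Pn a := fun {a b} ha hab => by
    induction b, hab using Nat.le_induction with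
    | base => exact subset_rfl
    | succ n hn ih => exact (hchain n (ha.trans hn)).subset.trans ih
  refine ⟨fun h => ?_, anti hm⟩
  by_contra! hlt
  exact (hchain k hk).not_subset (h.trans (anti (Nat.le_add_left 1 k) hlt))

/-- If the primes of `M` form a strictly decreasing chain `P₁ ⊋ P₂ ⊋ ⋯` together with a
smallest prime `P∞ ⊊ Pₙ`, then the closed sets of the topology whose closed sets are the
`Z F` are exactly: `∅`, the whole space, `{P∞}`, and the tails `{Pₖ : k ≥ m} ∪ {P∞}`
for `m ≥ 2`. -/
theorem stmt_2 {M : Type*} (mul add : M → M → M) (z : M)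
    (Pn : ℕ → Set M) (Pinf : Set M)
    (hPn : ∀ n : ℕ, 1 ≤ n → IsPrimeSubset mul add z (Pn n))
    (hPinf : IsPrimeSubset mul add z Pinf)
    (hchain : ∀ n : ℕ, 1 ≤ n → Pn (n + 1) ⊂ Pn n)
    (hbot : ∀ n : ℕ, 1 ≤ n → Pinf ⊂ Pn n)
    (hall : ∀ Q : Set M, IsPrimeSubset mul add z Q →
      (∃ n : ℕ, 1 ≤ n ∧ Q = Pn n) ∨ Q = Pinf)
    [t : TopologicalSpace (PrimeSpace mul add z)]
    (ht : ∀ s : Set (PrimeSpace mul add z),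
      IsClosed s ↔ ∃ F : Set M, s = ZSet mul add z F) :
    ∀ s : Set (PrimeSpace mul add z),
      IsClosed s ↔
        s = ∅ ∨ s = Set.univ ∨
        s = {x : PrimeSpace mul add z | x.1 = Pinf} ∨
        ∃ m : ℕ, 2 ≤ m ∧
          s = {x : PrimeSpace mul add z | x.1 = Pinf ∨ ∃ k : ℕ, m ≤ k ∧ x.1 = Pn k} := by
  intro s
  have sub := @subset_iff_le_of_chain M Pn hchain
  constructor
  · intro hs
    obtain ⟨F, rfl⟩ := (ht s).1 hs
    by_cases hinf : (⟨Pinf, hPinf⟩ : PrimeSpace mul add z) ∈ ZSet mul add z F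
    · right
      by_cases hex : ∃ n, ∃ hn : 1 ≤ n,
          (⟨Pn n, hPn n hn⟩ : PrimeSpace mul add z) ∈ ZSet mul add z F
      · classical
        obtain ⟨hm, hmem⟩ := Nat.find_spec hex
        have hmin := fun n (hn : 1 ≤ n) h => Nat.find_min' hex (m := n) ⟨hn, h⟩
        generalize Nat.find hex = m at hm hmem hmin
        have htail : ∀ k (hk : 1 ≤ k),
            (⟨Pn k, hPn k hk⟩ : PrimeSpace mul add z) ∈ ZSet mul add z F ↔ m ≤ k :=
          fun k hk => ⟨hmin k hk, fun h => mem_ZSet_of_subset ((sub hm hk).2 h) hmem⟩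
        rcases hm.eq_or_lt with rfl | hm2
        · left
          refine Set.eq_univ_of_forall ?_
          rintro ⟨Q, hQ⟩
          obtain ⟨n, hn, rfl⟩ | rfl := hall Q hQ
          exacts [(htail n hn).2 hn, hinf]
        · refine Or.inr (Or.inr ⟨m, hm2, ?_⟩)
          ext ⟨Q, hQ⟩
          constructor
          · intro h
            obtain ⟨n, hn, rfl⟩ | rfl := hall Q hQ
            exacts [Or.inr ⟨n, (htail n hn).1 h, rfl⟩, Or.inl rfl]
          · rintro (rfl | ⟨k, hk, rfl⟩)
            exacts [hinf, (htail k (hm.trans hk)).2 hk]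
      · right
        left
        ext ⟨Q, hQ⟩
        constructor
        · intro h
          obtain ⟨n, hn, rfl⟩ | rfl := hall Q hQ
          exacts [(hex ⟨n, hn, h⟩).elim, rfl]
        · rintro rfl
          exact hinf
    · left
      refine Set.eq_empty_of_forall_notMem ?_
      rintro ⟨Q, hQ⟩ h
      refine hinf (mem_ZSet_of_subset ?_ h)
      obtain ⟨n, hn, rfl⟩ | rfl := hall Q hQ
      exacts [(hbot n hn).subset, subset_rfl]
  · rintro (rfl | rfl | rfl | ⟨m, hm, rfl⟩)
    · exact isClosed_empty
    · exact isClosed_univ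
    · refine (ht _).2 ⟨Pinfᶜ, ?_⟩
      rw [ZSet_compl]
      ext ⟨Q, hQ⟩
      refine ⟨fun h => Eq.subset h, fun h => ?_⟩
      obtain ⟨n, hn, rfl⟩ | rfl := hall Q hQ
      exacts [((hbot n hn).not_subset h).elim, rfl]
    · have hm1 : 1 ≤ m := by lia
      refine (ht _).2 ⟨(Pn m)ᶜ, ?_⟩
      rw [ZSet_compl]
      ext ⟨Q, hQ⟩
      constructor
      · rintro (rfl | ⟨k, hk, rfl⟩)
        exacts [(hbot m hm1).subset, (sub hm1 (hm1.trans hk)).2 hk]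
      · intro h
        obtain ⟨n, hn, rfl⟩ | rfl := hall Q hQ
        exacts [Or.inr ⟨n, (sub hm1 hn).1 h, rfl⟩, Or.inl rfl]
end

section
/- Suppose the tensor unit 𝟙 generates C as a triangulated category, in the sense that the only triangulated subcategory of C containing 𝟙 is C itself. Then every triangulated subcategory A of C is a ⊗-ideal: if Q ∈ A and P is any object of C, then P ⊗ Q ∈ A. In particular, every thick subcategory of C is a thick ⊗-ideal. -/
open CategoryTheory Limits Pretriangulated ZeroObject MonoidalCategory

variable (C : Type*) [Category C] [HasZeroObject C] [HasShift C ℤ] [Preadditive C]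
  [∀ n : ℤ, (CategoryTheory.shiftFunctor C n).Additive] [Pretriangulated C]

/-- A (strictly full) triangulated subcategory, given by its set of objects: closed under
isomorphisms, contains `0`, stable under the shift `Σ` and its inverse, and contains the
third object of any distinguished triangle whose other two objects it contains. -/
def IsTriangulatedSubcat (A : Set C) : Prop :=
  (∀ X Y : C, (X ≅ Y) → X ∈ A → Y ∈ A) ∧
  ((0 : C) ∈ A) ∧
  (∀ X : C, X ∈ A → X⟦(1 : ℤ)⟧ ∈ A) ∧
  (∀ X : C, X ∈ A → X⟦(-1 : ℤ)⟧ ∈ A) ∧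
  (∀ T : Triangle C, (T ∈ distTriang C) → T.obj₁ ∈ A → T.obj₂ ∈ A → T.obj₃ ∈ A)

/-- A thick subcategory: a triangulated subcategory closed under retracts. -/
def IsThickSubcat (A : Set C) : Prop :=
  IsTriangulatedSubcat C A ∧
  (∀ X Y : C, (∃ (i : Y ⟶ X) (r : X ⟶ Y), i ≫ r = 𝟙 Y) → X ∈ A → Y ∈ A)

/-- A `⊗`-ideal: `Q ∈ A` and `P` arbitrary imply `P ⊗ Q ∈ A`. -/
def IsTensorIdeal [MonoidalCategory C] (A : Set C) : Prop :=
  ∀ P Q : C, Q ∈ A → (P ⊗ Q) ∈ A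

/-- The preimage of a triangulated subcategory under a triangulated functor is a triangulated
subcategory. -/
theorem IsTriangulatedSubcat.preimage {D : Type*} [Category D] [HasZeroObject D] [HasShift D ℤ]
    [Preadditive D] [∀ n : ℤ, (CategoryTheory.shiftFunctor D n).Additive] [Pretriangulated D]
    (F : C ⥤ D) [F.CommShift ℤ] [F.IsTriangulated] {A : Set D}
    (hA : IsTriangulatedSubcat D A) : IsTriangulatedSubcat C {X | F.obj X ∈ A} := by
  obtain ⟨h_iso, h_zero, h_shift, h_unshift, h_dist⟩ := hA
  refine ⟨fun X Y e hX => h_iso _ _ (F.mapIso e) hX, h_iso _ _ F.mapZeroObject.symm h_zero,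
    fun X hX => h_iso _ _ ((F.commShiftIso (1 : ℤ)).app X).symm (h_shift _ hX),
    fun X hX => h_iso _ _ ((F.commShiftIso (-1 : ℤ)).app X).symm (h_unshift _ hX),
    fun T hT h₁ h₂ => h_dist _ (F.map_distinguished T hT) h₁ h₂⟩

/-- If the tensor unit generates `C` as a triangulated category, then every triangulated
subcategory of `C` is a `⊗`-ideal; in particular every thick subcategory is a thick
`⊗`-ideal. -/
theorem stmt_4 [MonoidalCategory C] [SymmetricCategory C]
    [∀ P : C, (tensorLeft P).CommShift ℤ]
    [∀ P : C, (tensorLeft P).IsTriangulated]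
    (hgen : ∀ A : Set C, IsTriangulatedSubcat C A → (𝟙_ C) ∈ A → A = Set.univ) :
    (∀ A : Set C, IsTriangulatedSubcat C A → IsTensorIdeal C A) ∧
    (∀ A : Set C, IsThickSubcat C A → IsTensorIdeal C A) := by
  have ideal : ∀ A : Set C, IsTriangulatedSubcat C A → IsTensorIdeal C A := by
    intro A hA P Q hQ
    have hP : P ∈ {X : C | (tensorLeft Q).obj X ∈ A} := by
      rw [hgen _ (hA.preimage C (tensorLeft Q)) (hA.1 _ _ (ρ_ Q).symm hQ)]
      exact Set.mem_univ P
    exact hA.1 _ _ (β_ Q P) hP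
  exact ⟨ideal, fun A hA => ideal A hA.1⟩
end

section
/- Let M be a thick ⊗-ideal of C with M ≠ C which is maximal among proper thick subcategories, i.e. every thick subcategory A of C with M ⊆ A satisfies A = M or A = C. Then M is a prime of C: whenever P ⊗ Q ∈ M for objects P, Q of C, either P ∈ M or Q ∈ M. -/
open CategoryTheory Limits Pretriangulated ZeroObject MonoidalCategory

variable (C : Type*) [Category C] [HasZeroObject C] [HasShift C ℤ] [Preadditive C]
  [∀ n : ℤ, (CategoryTheory.shiftFunctor C n).Additive] [Pretriangulated C]

variable {C} in
/-- The preimage of a thick subcategory under a triangulated functor is thick. -/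
theorem IsThickSubcat.preimage (F : C ⥤ C) [F.CommShift ℤ] [F.IsTriangulated] {M : Set C}
    (hM : IsThickSubcat C M) : IsThickSubcat C {X | F.obj X ∈ M} := by
  obtain ⟨⟨hiso, hzero, hshift, hshift', htri⟩, hretract⟩ := hM
  refine ⟨⟨fun X Y e hX => hiso _ _ (F.mapIso e) hX, hiso _ _ F.mapZeroObject.symm hzero,
    fun X hX => hiso _ _ ((F.commShiftIso (1 : ℤ)).app X).symm (hshift _ hX),
    fun X hX => hiso _ _ ((F.commShiftIso (-1 : ℤ)).app X).symm (hshift' _ hX),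
    fun T hT h₁ h₂ => htri _ (F.map_distinguished T hT) h₁ h₂⟩, ?_⟩
  rintro X Y ⟨i, r, hir⟩ hX
  exact hretract _ _ ⟨F.map i, F.map r, by rw [← F.map_comp, hir, F.map_id]⟩ hX

/-- If `M` is a proper thick `⊗`-ideal which is maximal among proper thick subcategories,
then `M` is a prime: `P ⊗ Q ∈ M` implies `P ∈ M` or `Q ∈ M`. -/
theorem stmt_6 [MonoidalCategory C] [SymmetricCategory C]
    [∀ P : C, (tensorLeft P).CommShift ℤ]
    [∀ P : C, (tensorLeft P).IsTriangulated]
    (M : Set C) (hthick : IsThickSubcat C M) (hideal : IsTensorIdeal C M)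
    (hproper : M ≠ Set.univ)
    (hmax : ∀ A : Set C, IsThickSubcat C A → M ⊆ A → A = M ∨ A = Set.univ) :
    ∀ P Q : C, (P ⊗ Q) ∈ M → P ∈ M ∨ Q ∈ M := by
  intro P Q hPQ
  rcases hmax {X | (tensorLeft P).obj X ∈ M} (hthick.preimage (tensorLeft P))
    (fun X hX => hideal P X hX) with h | h
  · exact Or.inr (h ▸ hPQ)
  · have hP : 𝟙_ C ∈ {X | (tensorLeft P).obj X ∈ M} := h ▸ Set.mem_univ _
    exact Or.inl (hthick.1.1 _ _ (ρ_ P) hP)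
end

section
/- Suppose that every thick subcategory of C is a ⊗-ideal, that M is a proper thick subcategory of C which contains every proper thick subcategory of C, and that for every proper thick subcategory A of C with A ≠ M there exist objects P ∉ A and Q ∉ A with P ⊗ Q ≅ 0. Then M is the unique prime of C. -/
open CategoryTheory Limits Pretriangulated ZeroObject MonoidalCategory

variable (C : Type*) [Category C] [HasZeroObject C] [HasShift C ℤ] [Preadditive C]
  [∀ n : ℤ, (CategoryTheory.shiftFunctor C n).Additive] [Pretriangulated C]

/-- A prime of `C`: a proper thick `⊗`-ideal `A` such that `P ⊗ Q ∈ A` implies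
`P ∈ A` or `Q ∈ A`. -/
def IsPrimeSubcat [MonoidalCategory C] (A : Set C) : Prop :=
  IsThickSubcat C A ∧ IsTensorIdeal C A ∧ A ≠ Set.univ ∧
  ∀ P Q : C, (P ⊗ Q) ∈ A → P ∈ A ∨ Q ∈ A

/-- The objects `X` with `P ⊗ X` in a given thick subcategory form a thick subcategory. -/
theorem IsThickSubcat.preimage_tensorLeft [MonoidalCategory C] (P : C)
    [(tensorLeft P).CommShift ℤ] [(tensorLeft P).IsTriangulated]
    {A : Set C} (hA : IsThickSubcat C A) : IsThickSubcat C {X : C | P ⊗ X ∈ A} := by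
  obtain ⟨⟨hiso, hzero, hshift, hshift', htri⟩, hretract⟩ := hA
  refine ⟨⟨fun X Y e hX => hiso _ _ ((tensorLeft P).mapIso e) hX, ?_, fun X hX => ?_,
    fun X hX => ?_, fun T hT h₁ h₂ => ?_⟩, ?_⟩
  · exact hiso _ _ ((tensorLeft P).map_isZero (isZero_zero C)).isoZero.symm hzero
  · exact hiso _ _ (((tensorLeft P).commShiftIso (1 : ℤ)).app X).symm (hshift _ hX)
  · exact hiso _ _ (((tensorLeft P).commShiftIso (-1 : ℤ)).app X).symm (hshift' _ hX)
  · exact htri _ ((tensorLeft P).map_distinguished T hT) h₁ h₂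
  · rintro X Y ⟨i, r, hir⟩ hX
    refine hretract _ _ ⟨P ◁ i, P ◁ r, ?_⟩ hX
    rw [← MonoidalCategory.whiskerLeft_comp, hir, MonoidalCategory.whiskerLeft_id]

/-- If every thick subcategory of `C` is a `⊗`-ideal, `M` is a proper thick subcategory
containing every proper thick subcategory, and every proper thick subcategory `A ≠ M`
misses two objects `P, Q` with `P ⊗ Q ≅ 0`, then `M` is the unique prime of `C`. -/
theorem stmt_7 [MonoidalCategory C] [SymmetricCategory C]
    [∀ P : C, (tensorLeft P).CommShift ℤ]
    [∀ P : C, (tensorLeft P).IsTriangulated]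
    (M : Set C) (hM : IsThickSubcat C M) (hproper : M ≠ Set.univ)
    (hideals : ∀ A : Set C, IsThickSubcat C A → IsTensorIdeal C A)
    (hgreatest : ∀ A : Set C, IsThickSubcat C A → A ≠ Set.univ → A ⊆ M)
    (hkill : ∀ A : Set C, IsThickSubcat C A → A ≠ Set.univ → A ≠ M →
      ∃ P Q : C, P ∉ A ∧ Q ∉ A ∧ Nonempty ((P ⊗ Q) ≅ (0 : C))) :
    IsPrimeSubcat C M ∧ ∀ A : Set C, IsPrimeSubcat C A → A = M := by
  refine ⟨⟨hM, hideals M hM, hproper, fun P Q hPQ => ?_⟩, fun A hA => ?_⟩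
  · by_cases hB : {X : C | Q ⊗ X ∈ M} = Set.univ
    · have hunit : 𝟙_ C ∈ {X : C | Q ⊗ X ∈ M} := hB ▸ Set.mem_univ _
      exact Or.inr (hM.1.1 _ _ (ρ_ Q) hunit)
    · exact Or.inl (hgreatest _ (hM.preimage_tensorLeft C Q) hB (hM.1.1 _ _ (β_ P Q) hPQ))
  · obtain ⟨hthick, -, hne, hprime⟩ := hA
    by_contra hAM
    obtain ⟨P, Q, hP, hQ, ⟨e⟩⟩ := hkill A hthick hne hAM
    exact (hprime P Q (hthick.1.1 _ _ e.symm hthick.1.2.1)).elim hP hQ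
end
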